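/- Let A be a fanning frame, F its fundamental endomorphism, D(t) := (1/k)(2F'(t) − (k−2)·I) and P(t) := (I − D(t))/2. Then for every t ∈ ℝ: P'(t)·A^{(i)}(t) = 0 for all 0 ≤ i ≤ k−3; P'(t)·A^{(k−2)}(t) = A^{(k−1)}(t) − (1/k)F(t)A^{(k)}(t), and this (kn)×n matrix has rank n; moreover P'(t)P(t) = (I − P(t))P'(t), so that P'(t) maps the kernel of P(t) into its range and the range of P(t) into its kernel. -/

import Mathlib

open Matrix

noncomputable def mderiv {M N : ℕ} (A : ℝ → Matrix (Fin M) (Fin N) ℝ) :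
    ℝ → Matrix (Fin M) (Fin N) ℝ :=
  fun t => Matrix.of fun i j => deriv (fun s => A s i j) t

noncomputable def dmat {M N : ℕ} (i : ℕ) (A : ℝ → Matrix (Fin M) (Fin N) ℝ) :
    ℝ → Matrix (Fin M) (Fin N) ℝ :=
  mderiv^[i] A

def MatSmooth {M N : ℕ} (A : ℝ → Matrix (Fin M) (Fin N) ℝ) : Prop :=
  ∀ i j, ContDiff ℝ (⊤ : ℕ∞) fun t => A t i j

def juxt (k n : ℕ) (B : Fin k → Matrix (Fin (k * n)) (Fin n) ℝ) :
    Matrix (Fin (k * n)) (Fin (k * n)) ℝ :=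
  Matrix.of fun r c => B (finProdFinEquiv.symm c).1 r (finProdFinEquiv.symm c).2

noncomputable def frameMat (k n : ℕ) (A : ℝ → Matrix (Fin (k * n)) (Fin n) ℝ) (t : ℝ) :
    Matrix (Fin (k * n)) (Fin (k * n)) ℝ :=
  juxt k n fun i => dmat (i : ℕ) A t

def IsFanning (k n : ℕ) (A : ℝ → Matrix (Fin (k * n)) (Fin n) ℝ) : Prop :=
  MatSmooth A ∧ ∀ t, IsUnit (frameMat k n A t)

def IsCoeffs (k n : ℕ) (A : ℝ → Matrix (Fin (k * n)) (Fin n) ℝ)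
    (P : ℕ → ℝ → Matrix (Fin n) (Fin n) ℝ) : Prop :=
  (∀ i ∈ Finset.Icc 1 k, MatSmooth (P i)) ∧
  ∀ t, dmat k A t + ∑ i ∈ Finset.Icc 1 k, (k.choose i : ℝ) • (dmat (k - i) A t * P i t) = 0

noncomputable def Nmat (k n : ℕ) : Matrix (Fin (k * n)) (Fin (k * n)) ℝ :=
  Matrix.of fun r c =>
    if ((finProdFinEquiv.symm c).1 : ℕ) = ((finProdFinEquiv.symm r).1 : ℕ) + 1 ∧
        (finProdFinEquiv.symm c).2 = (finProdFinEquiv.symm r).2 then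
      (((finProdFinEquiv.symm r).1 : ℕ) + 1 : ℝ)
    else 0

noncomputable def fundEnd (k n : ℕ) (A : ℝ → Matrix (Fin (k * n)) (Fin n) ℝ) (t : ℝ) :
    Matrix (Fin (k * n)) (Fin (k * n)) ℝ :=
  frameMat k n A t * Nmat k n * (frameMat k n A t)⁻¹

noncomputable def fundRefl (k n : ℕ) (A : ℝ → Matrix (Fin (k * n)) (Fin n) ℝ) (t : ℝ) :
    Matrix (Fin (k * n)) (Fin (k * n)) ℝ :=
  (k : ℝ)⁻¹ • ((2 : ℝ) • mderiv (fundEnd k n A) t - ((k : ℝ) - 2) • (1 : Matrix (Fin (k * n)) (Fin (k * n)) ℝ))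

noncomputable def fundProj (k n : ℕ) (A : ℝ → Matrix (Fin (k * n)) (Fin n) ℝ) (t : ℝ) :
    Matrix (Fin (k * n)) (Fin (k * n)) ℝ :=
  (2 : ℝ)⁻¹ • ((1 : Matrix (Fin (k * n)) (Fin (k * n)) ℝ) - fundRefl k n A t)

noncomputable def horDer (k n : ℕ) (A : ℝ → Matrix (Fin (k * n)) (Fin n) ℝ)
    (P : ℕ → ℝ → Matrix (Fin n) (Fin n) ℝ) (t : ℝ) : Matrix (Fin (k * n)) (Fin n) ℝ :=
  dmat (k - 1) A t + ∑ i ∈ Finset.Icc 1 (k - 1), ((k - 1).choose i : ℝ) • (dmat (k - 1 - i) A t * P i t)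

noncomputable def jacobiEnd (k n : ℕ) (A : ℝ → Matrix (Fin (k * n)) (Fin n) ℝ) (t : ℝ) :
    Matrix (Fin (k * n)) (Fin (k * n)) ℝ :=
  (((k : ℝ)) ^ 2)⁻¹ • (mderiv (mderiv (fundEnd k n A)) t * mderiv (mderiv (fundEnd k n A)) t)

namespace MatSmooth

variable {M N K : ℕ}

lemma differentiableAt {A : ℝ → Matrix (Fin M) (Fin N) ℝ} (hA : MatSmooth A) (i : Fin M)
    (j : Fin N) (t : ℝ) : DifferentiableAt ℝ (fun s => A s i j) t :=
  ((hA i j).differentiable (by simp)).differentiableAt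

lemma mderiv {A : ℝ → Matrix (Fin M) (Fin N) ℝ} (hA : MatSmooth A) : MatSmooth (mderiv A) :=
  fun i j => (contDiff_infty_iff_deriv.1 (hA i j)).2

lemma dmat {A : ℝ → Matrix (Fin M) (Fin N) ℝ} (hA : MatSmooth A) (i : ℕ) :
    MatSmooth (dmat i A) := by
  induction i with
  | zero => exact hA
  | succ i ih =>
    rw [_root_.dmat, Function.iterate_succ_apply']
    exact ih.mderiv

lemma const (C : Matrix (Fin M) (Fin N) ℝ) : MatSmooth fun _ => C :=
  fun _ _ => contDiff_const

lemma sub {A B : ℝ → Matrix (Fin M) (Fin N) ℝ} (hA : MatSmooth A) (hB : MatSmooth B) :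
    MatSmooth fun t => A t - B t :=
  fun i j => (hA i j).sub (hB i j)

lemma const_smul {A : ℝ → Matrix (Fin M) (Fin N) ℝ} (c : ℝ) (hA : MatSmooth A) :
    MatSmooth fun t => c • A t :=
  fun i j => contDiff_const.mul (hA i j)

lemma mul {A : ℝ → Matrix (Fin M) (Fin N) ℝ} {B : ℝ → Matrix (Fin N) (Fin K) ℝ}
    (hA : MatSmooth A) (hB : MatSmooth B) : MatSmooth fun t => A t * B t := by
  intro i j
  simp only [Matrix.mul_apply]
  exact ContDiff.sum fun l _ => (hA i l).mul (hB l j)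

lemma contDiff_det {A : ℝ → Matrix (Fin N) (Fin N) ℝ} (hA : MatSmooth A) :
    ContDiff ℝ (⊤ : ℕ∞) fun t => (A t).det := by
  simp only [Matrix.det_apply']
  exact ContDiff.sum fun σ _ => contDiff_const.mul (contDiff_prod fun l _ => hA _ _)

lemma adjugate {A : ℝ → Matrix (Fin N) (Fin N) ℝ} (hA : MatSmooth A) :
    MatSmooth fun t => (A t).adjugate := by
  intro i j
  simp only [Matrix.adjugate_apply]
  refine contDiff_det fun p q => ?_
  simp only [Matrix.updateRow_apply]
  split_ifs
  · exact contDiff_const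
  · exact hA p q

lemma inv {A : ℝ → Matrix (Fin N) (Fin N) ℝ} (hA : MatSmooth A) (hu : ∀ t, IsUnit (A t)) :
    MatSmooth fun t => (A t)⁻¹ := by
  intro i j
  simp only [Matrix.inv_def, Ring.inverse_eq_inv', Matrix.smul_apply, smul_eq_mul]
  exact (hA.contDiff_det.inv fun t => ((Matrix.isUnit_iff_isUnit_det _).1 (hu t)).ne_zero).mul
    (hA.adjugate i j)

end MatSmooth

section Derivative

variable {M N K : ℕ}

lemma dmat_succ (i : ℕ) (A : ℝ → Matrix (Fin M) (Fin N) ℝ) :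
    dmat (i + 1) A = mderiv (dmat i A) :=
  Function.iterate_succ_apply' _ _ _

lemma mderiv_const_smul (c : ℝ) (A : ℝ → Matrix (Fin M) (Fin N) ℝ) (t : ℝ) :
    mderiv (fun s => c • A s) t = c • mderiv A t := by
  ext i j
  simp [mderiv]

lemma mderiv_mul {A : ℝ → Matrix (Fin M) (Fin N) ℝ} {B : ℝ → Matrix (Fin N) (Fin K) ℝ}
    (hA : MatSmooth A) (hB : MatSmooth B) (t : ℝ) :
    mderiv (fun s => A s * B s) t = mderiv A t * B t + A t * mderiv B t := by
  ext i j
  simp only [mderiv, Matrix.mul_apply, Matrix.of_apply, Matrix.add_apply]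
  rw [deriv_fun_sum fun l _ =>
      (hA.differentiableAt i l t).fun_mul (hB.differentiableAt l j t),
    ← Finset.sum_add_distrib]
  exact Finset.sum_congr rfl fun l _ =>
    deriv_fun_mul (hA.differentiableAt i l t) (hB.differentiableAt l j t)

end Derivative

section Frame

variable {k n : ℕ} {A : ℝ → Matrix (Fin (k * n)) (Fin n) ℝ}

lemma frameMat_submatrix (t : ℝ) (i : Fin k) :
    (frameMat k n A t).submatrix id (fun c => finProdFinEquiv (i, c)) = dmat i A t := by
  ext r c
  simp only [frameMat, juxt, Matrix.submatrix_apply, Matrix.of_apply, id_eq,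
    Equiv.symm_apply_apply]

lemma Nmat_submatrix_zero (i : Fin k) (hi : (i : ℕ) = 0) :
    (Nmat k n).submatrix id (fun c => finProdFinEquiv (i, c)) = 0 := by
  ext r c
  simp only [Nmat, Matrix.submatrix_apply, Matrix.of_apply, id_eq, Equiv.symm_apply_apply,
    Matrix.zero_apply]
  rw [if_neg (by lia)]

lemma Nmat_submatrix_succ (i : Fin k) (j : Fin k) (hij : (j : ℕ) = i + 1) :
    (Nmat k n).submatrix id (fun c => finProdFinEquiv (j, c)) =
      ((i : ℝ) + 1) • (1 : Matrix (Fin (k * n)) (Fin (k * n)) ℝ).submatrix id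
        (fun c => finProdFinEquiv (i, c)) := by
  ext r c
  obtain ⟨⟨a, b⟩, rfl⟩ := finProdFinEquiv.surjective r
  simp only [Nmat, Matrix.submatrix_apply, Matrix.of_apply, id_eq, Equiv.symm_apply_apply,
    Matrix.smul_apply, Matrix.one_apply, EmbeddingLike.apply_eq_iff_eq, Prod.mk.injEq,
    smul_eq_mul, mul_ite, mul_one, mul_zero, hij, add_left_inj]
  by_cases h : a = i ∧ b = c
  · rw [if_pos h, if_pos ⟨by rw [h.1], h.2.symm⟩, h.1]
  · rw [if_neg h, if_neg fun h' => h ⟨Fin.ext h'.1.symm, h'.2.symm⟩]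

lemma Nmat_submatrix_last (i : Fin k) (hi : (i : ℕ) + 1 = k) :
    (Nmat k n).submatrix (fun c => finProdFinEquiv (i, c)) id = 0 := by
  ext r c
  simp only [Nmat, Matrix.submatrix_apply, Matrix.of_apply, id_eq, Equiv.symm_apply_apply,
    Matrix.zero_apply]
  rw [if_neg]
  rintro ⟨h, -⟩
  have := (finProdFinEquiv.symm c).1.isLt
  lia

lemma frameMat_mul_one_submatrix (t : ℝ) (i : Fin k) :
    frameMat k n A t * (1 : Matrix (Fin (k * n)) (Fin (k * n)) ℝ).submatrix id
      (fun c => finProdFinEquiv (i, c)) = dmat i A t := by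
  rw [← frameMat_submatrix (A := A) t i]
  ext r c
  simp [Matrix.mul_apply, Matrix.one_apply]

namespace IsFanning

lemma frameMat_smooth (hA : IsFanning k n A) : MatSmooth (frameMat k n A) :=
  fun r _ => hA.1.dmat _ r _

lemma fundEnd_smooth (hA : IsFanning k n A) : MatSmooth (fundEnd k n A) :=
  (hA.frameMat_smooth.mul (.const _)).mul (hA.frameMat_smooth.inv hA.2)

lemma fundProj_smooth (hA : IsFanning k n A) : MatSmooth (fundProj k n A) :=
  ((MatSmooth.const 1).sub
    (((hA.fundEnd_smooth.mderiv.const_smul 2).sub (.const _)).const_smul _)).const_smul _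

lemma isUnit_det (hA : IsFanning k n A) (t : ℝ) : IsUnit (frameMat k n A t).det :=
  (Matrix.isUnit_iff_isUnit_det _).1 (hA.2 t)

/-- Two endomorphisms that agree on `A, …, A^{(k-1)}` are equal. -/
lemma ext_of_mul_dmat (hA : IsFanning k n A) (t : ℝ)
    {X Y : Matrix (Fin (k * n)) (Fin (k * n)) ℝ}
    (h : ∀ i < k, X * dmat i A t = Y * dmat i A t) : X = Y := by
  refine (hA.2 t).mul_right_cancel ?_
  ext r c
  obtain ⟨⟨i, c⟩, rfl⟩ := finProdFinEquiv.surjective c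
  have := congrFun (congrFun (h i i.isLt) r) c
  rw [← frameMat_submatrix] at this
  simpa [Matrix.mul_apply] using this

lemma fundEnd_mul_dmat_eq (hA : IsFanning k n A) (t : ℝ) (i : Fin k) :
    fundEnd k n A t * dmat i A t =
      frameMat k n A t * (Nmat k n).submatrix id (fun c => finProdFinEquiv (i, c)) := by
  rw [← frameMat_mul_one_submatrix t i, ← Matrix.mul_assoc, fundEnd,
    Matrix.nonsing_inv_mul_cancel_right _ _ (hA.isUnit_det t), Matrix.mul_assoc]
  congr 1
  ext r c
  simp [Matrix.mul_apply, Matrix.one_apply]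

lemma fundEnd_mul_dmat_zero (hA : IsFanning k n A) (hk : 0 < k) (t : ℝ) :
    fundEnd k n A t * dmat 0 A t = 0 := by
  rw [hA.fundEnd_mul_dmat_eq t ⟨0, hk⟩, Nmat_submatrix_zero _ rfl, Matrix.mul_zero]

lemma fundEnd_mul_dmat_succ (hA : IsFanning k n A) {i : ℕ} (hi : i + 1 < k) (t : ℝ) :
    fundEnd k n A t * dmat (i + 1) A t = ((i : ℝ) + 1) • dmat i A t := by
  rw [hA.fundEnd_mul_dmat_eq t ⟨i + 1, hi⟩, Nmat_submatrix_succ ⟨i, by lia⟩ _ rfl,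
    Matrix.mul_smul, frameMat_mul_one_submatrix]

lemma fundEnd_mul_dmat (hA : IsFanning k n A) {i : ℕ} (hi : i < k) (t : ℝ) :
    fundEnd k n A t * dmat i A t = (i : ℝ) • dmat (i - 1) A t := by
  cases i with
  | zero => simpa using hA.fundEnd_mul_dmat_zero hi t
  | succ i => simpa using hA.fundEnd_mul_dmat_succ hi t

lemma mderiv_fundEnd_mul_dmat (hA : IsFanning k n A) {i : ℕ} (hi : i < k) (t : ℝ) :
    mderiv (fundEnd k n A) t * dmat i A t =
      (i : ℝ) • dmat i A t - fundEnd k n A t * dmat (i + 1) A t := by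
  have h := mderiv_mul hA.fundEnd_smooth (hA.1.dmat i) t
  rw [funext (hA.fundEnd_mul_dmat hi), mderiv_const_smul, ← dmat_succ, ← dmat_succ] at h
  rw [eq_sub_iff_add_eq, ← h]
  cases i <;> simp

lemma fundProj_eq (hk : k ≠ 0) (t : ℝ) :
    fundProj k n A t = (k : ℝ)⁻¹ • (((k : ℝ) - 1) • 1 - mderiv (fundEnd k n A) t) := by
  have : (k : ℝ) ≠ 0 := by exact_mod_cast hk
  ext i j
  simp only [fundProj, fundRefl, Matrix.smul_apply, Matrix.sub_apply, smul_eq_mul]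
  field_simp
  ring

lemma fundProj_mul_dmat_eq (hA : IsFanning k n A) {i : ℕ} (hi : i < k) (t : ℝ) :
    fundProj k n A t * dmat i A t =
      (k : ℝ)⁻¹ • (((k : ℝ) - 1 - i) • dmat i A t + fundEnd k n A t * dmat (i + 1) A t) := by
  rw [fundProj_eq (by lia), Matrix.smul_mul, Matrix.sub_mul, hA.mderiv_fundEnd_mul_dmat hi,
    Matrix.smul_mul, Matrix.one_mul, sub_smul _ (i : ℝ), sub_sub_eq_add_sub, sub_add_eq_add_sub]

lemma fundProj_mul_dmat (hA : IsFanning k n A) {i : ℕ} (hi : i + 1 < k) (t : ℝ) :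
    fundProj k n A t * dmat i A t = dmat i A t := by
  have : (k : ℝ) ≠ 0 := by exact_mod_cast (by lia : k ≠ 0)
  rw [hA.fundProj_mul_dmat_eq (by lia), hA.fundEnd_mul_dmat_succ hi, ← add_smul,
    show (k : ℝ) - 1 - i + (i + 1) = k by ring, smul_smul, inv_mul_cancel₀ this, one_smul]

lemma fundProj_mul_dmat_last (hA : IsFanning k n A) (hk : 0 < k) (t : ℝ) :
    fundProj k n A t * dmat (k - 1) A t = (k : ℝ)⁻¹ • (fundEnd k n A t * dmat k A t) := by
  rw [hA.fundProj_mul_dmat_eq (by lia), Nat.sub_add_cancel hk, Nat.cast_sub hk]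
  simp

lemma fundProj_mul_fundEnd (hA : IsFanning k n A) (t : ℝ) :
    fundProj k n A t * fundEnd k n A t = fundEnd k n A t := by
  refine hA.ext_of_mul_dmat t fun i hi => ?_
  rw [Matrix.mul_assoc, hA.fundEnd_mul_dmat hi, Matrix.mul_smul]
  cases i with
  | zero => simp
  | succ i => rw [Nat.add_sub_cancel, hA.fundProj_mul_dmat hi]

lemma fundProj_mul_self (hA : IsFanning k n A) (t : ℝ) :
    fundProj k n A t * fundProj k n A t = fundProj k n A t := by
  refine hA.ext_of_mul_dmat t fun i hi => ?_
  rw [Matrix.mul_assoc]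
  rcases Nat.lt_or_ge (i + 1) k with h | h
  · rw [hA.fundProj_mul_dmat h, hA.fundProj_mul_dmat h]
  · obtain rfl : i = k - 1 := by lia
    rw [hA.fundProj_mul_dmat_last (by lia), Matrix.mul_smul, ← Matrix.mul_assoc,
      hA.fundProj_mul_fundEnd]

lemma mderiv_fundProj_mul_dmat (hA : IsFanning k n A) {i : ℕ} (hi : i + 1 < k) (t : ℝ) :
    mderiv (fundProj k n A) t * dmat i A t =
      dmat (i + 1) A t - fundProj k n A t * dmat (i + 1) A t := by
  have h := mderiv_mul hA.fundProj_smooth (hA.1.dmat i) t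
  rw [funext (hA.fundProj_mul_dmat hi), ← dmat_succ] at h
  exact eq_sub_of_add_eq h.symm

lemma mderiv_fundProj_mul_fundProj (hA : IsFanning k n A) (t : ℝ) :
    mderiv (fundProj k n A) t * fundProj k n A t =
      (1 - fundProj k n A t) * mderiv (fundProj k n A) t := by
  have h := mderiv_mul hA.fundProj_smooth hA.fundProj_smooth t
  rw [funext hA.fundProj_mul_self] at h
  rw [Matrix.sub_mul, Matrix.one_mul]
  exact eq_sub_of_add_eq h.symm

/-- The last block row of `𝐀⁻¹` is a left inverse of `A^{(k-1)} - F X`. -/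
lemma rank_dmat_sub_fundEnd_mul (hA : IsFanning k n A) (hk : 0 < k) (t : ℝ)
    (X : Matrix (Fin (k * n)) (Fin n) ℝ) :
    (dmat (k - 1) A t - fundEnd k n A t * X).rank = n := by
  let i : Fin k := ⟨k - 1, by lia⟩
  let L : Matrix (Fin n) (Fin (k * n)) ℝ :=
    (1 : Matrix (Fin (k * n)) (Fin (k * n)) ℝ).submatrix (fun c => finProdFinEquiv (i, c)) id
  have hLN : L * Nmat k n = 0 := by
    rw [← Nmat_submatrix_last (n := n) i (Nat.sub_add_cancel hk)]
    ext r c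
    simp [L, Matrix.mul_apply, Matrix.one_apply]
  have hinv := Matrix.nonsing_inv_mul _ (hA.isUnit_det t)
  have hdmat : L * (frameMat k n A t)⁻¹ * dmat (k - 1) A t = 1 := by
    rw [← frameMat_mul_one_submatrix t i, Matrix.mul_assoc, ← Matrix.mul_assoc _ (frameMat k n A t),
      hinv, Matrix.one_mul]
    ext r c
    simp [L, Matrix.mul_apply, Matrix.one_apply]
  have hend : L * (frameMat k n A t)⁻¹ * (fundEnd k n A t * X) = 0 := by
    rw [← Matrix.mul_assoc, fundEnd, Matrix.mul_assoc (frameMat k n A t), ← Matrix.mul_assoc,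
      Matrix.mul_assoc L, hinv, Matrix.mul_one, ← Matrix.mul_assoc, hLN, Matrix.zero_mul,
      Matrix.zero_mul]
  refine le_antisymm ((Matrix.rank_le_width _).trans_eq rfl) ?_
  have h := Matrix.rank_mul_le_right (L * (frameMat k n A t)⁻¹)
    (dmat (k - 1) A t - fundEnd k n A t * X)
  rwa [Matrix.mul_sub, hdmat, hend, sub_zero, Matrix.rank_one, Fintype.card_fin] at h

end IsFanning

end Frame

/-- Properties of the derivative of the fundamental projection
`P(t) = (I - D(t))/2`: it kills `A, …, A^{(k-3)}`, sends `A^{(k-2)}` to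
`A^{(k-1)} - (1/k) F A^{(k)}` (of rank `n`), and satisfies `P' P = (I - P) P'`, so it
interchanges the kernel and the range of `P(t)`. -/
theorem stmt_7 (k n : ℕ) (hk : 2 ≤ k) (hn : 1 ≤ n)
    (A : ℝ → Matrix (Fin (k * n)) (Fin n) ℝ) (hA : IsFanning k n A) (t : ℝ) :
    (∀ i : ℕ, i + 3 ≤ k → mderiv (fundProj k n A) t * dmat i A t = 0) ∧
    mderiv (fundProj k n A) t * dmat (k - 2) A t =
      dmat (k - 1) A t - (k : ℝ)⁻¹ • (fundEnd k n A t * dmat k A t) ∧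
    (mderiv (fundProj k n A) t * dmat (k - 2) A t).rank = n ∧
    mderiv (fundProj k n A) t * fundProj k n A t =
      (1 - fundProj k n A t) * mderiv (fundProj k n A) t ∧
    (∀ v ∈ LinearMap.ker (fundProj k n A t).mulVecLin,
        (mderiv (fundProj k n A) t).mulVec v ∈ LinearMap.range (fundProj k n A t).mulVecLin) ∧
    (∀ v ∈ LinearMap.range (fundProj k n A t).mulVecLin,
        (mderiv (fundProj k n A) t).mulVec v ∈ LinearMap.ker (fundProj k n A t).mulVecLin) := by
  have hcompl := hA.mderiv_fundProj_mul_fundProj t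
  have hlast : mderiv (fundProj k n A) t * dmat (k - 2) A t =
      dmat (k - 1) A t - (k : ℝ)⁻¹ • (fundEnd k n A t * dmat k A t) := by
    rw [hA.mderiv_fundProj_mul_dmat (by lia), show k - 2 + 1 = k - 1 by lia,
      hA.fundProj_mul_dmat_last (by lia)]
  refine ⟨fun i hi => ?_, hlast, ?_, hcompl, fun v hv => ?_, fun v hv => ?_⟩
  · rw [hA.mderiv_fundProj_mul_dmat (by lia), hA.fundProj_mul_dmat (by lia), sub_self]
  · rw [hlast, ← Matrix.mul_smul]
    exact hA.rank_dmat_sub_fundEnd_mul (by lia) t _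
  · rw [LinearMap.mem_ker, Matrix.mulVecLin_apply] at hv
    refine ⟨(mderiv (fundProj k n A) t).mulVec v, ?_⟩
    have h := congrArg (fun X => X.mulVec v) hcompl
    simp only [← Matrix.mulVec_mulVec, hv, Matrix.mulVec_zero, Matrix.sub_mulVec,
      Matrix.one_mulVec] at h
    exact (sub_eq_zero.1 h.symm).symm
  · obtain ⟨w, rfl⟩ := hv
    rw [LinearMap.mem_ker, Matrix.mulVecLin_apply, Matrix.mulVecLin_apply, Matrix.mulVec_mulVec,
      Matrix.mulVec_mulVec, Matrix.mul_assoc, hcompl, ← Matrix.mul_assoc,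
      Matrix.mul_sub, hA.fundProj_mul_self,
      Matrix.mul_one, sub_self, Matrix.zero_mul, Matrix.zero_mulVec]
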